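/- Let n be a natural number and let α, β be complex numbers such that α + β + j ≠ 0 for every integer j with 2 ≤ j ≤ n + 1. Then for all complex x, Σ_{k=0}^{n} ((α+β+n+1)_k / (α+β+2)_k) · P_{n-k}^{(α+k, β+k)}(x) · P_k^{(-α-k-1, -β-k-1)}(x) = δ_{n,0}, where δ_{n,0} equals 1 if n = 0 and 0 otherwise. -/

import Mathlib

theorem chz (i j : ℕ) : ((i+j).choose j : ℂ) = (i+j).factorial / (i.factorial * j.factorial) := by
  have f1 : (i.factorial : ℂ) ≠ 0 := by exact_mod_cast i.factorial_ne_zero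
  have f2 : (j.factorial : ℂ) ≠ 0 := by exact_mod_cast j.factorial_ne_zero
  rw [Nat.add_choose, Nat.cast_div (Nat.factorial_mul_factorial_dvd_factorial_add i j)]
  · push_cast; rfl
  · push_cast; exact mul_ne_zero f1 f2

theorem pp_add (a : ℂ) (m k : ℕ) : (ascPochhammer ℂ (m+k)).eval a = (ascPochhammer ℂ m).eval a * (ascPochhammer ℂ k).eval (a+m) := by
  rw [← ascPochhammer_mul]; simp

theorem pp_refl (k : ℕ) (a : ℂ) : (ascPochhammer ℂ k).eval (1-a-k) = (-1)^k * (ascPochhammer ℂ k).eval a := by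
  induction k with
  | zero => simp
  | succ k ih =>
    have e : (1 - a - ((k+1:ℕ):ℂ)) + ((1:ℕ):ℂ) = 1 - a - k := by push_cast; ring
    rw [ascPochhammer_succ_eval k a, show (ascPochhammer ℂ (k+1)) = ascPochhammer ℂ (1+k) by rw [add_comm], pp_add, e, ih]
    simp; ring

theorem reidx (n : ℕ) (f : ℕ → ℕ → ℕ → ℂ) :
    ∑ k ∈ Finset.range (n+1), ∑ i ∈ Finset.range (n-k+1), ∑ j ∈ Finset.range (k+1), f k i j
    = ∑ l ∈ Finset.range (n+1), ∑ m ∈ Finset.range (n-l+1), ∑ j ∈ Finset.range (m+1), f (l+j) (m-j) j := by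
  simp only [Finset.sum_sigma']
  refine Finset.sum_bij' (fun x _ => ⟨x.1 - x.2.2, x.2.1 + x.2.2, x.2.2⟩) (fun x _ => ⟨x.1 + x.2.2, x.2.1 - x.2.2, x.2.2⟩) ?_ ?_ ?_ ?_ ?_
  · rintro ⟨a, b, c⟩ h; simp at h ⊢; omega
  · rintro ⟨a, b, c⟩ h; simp at h ⊢; omega
  · rintro ⟨a, b, c⟩ h; simp at h ⊢; omega
  · rintro ⟨a, b, c⟩ h; simp at h ⊢; omega
  · rintro ⟨a, b, c⟩ h; simp at h ⊢; congr 1; omega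

theorem pp_ne (n : ℕ) (s : ℂ) (h : ∀ j : ℤ, 2 ≤ j → j ≤ (n : ℤ) + 1 → s + (j : ℂ) ≠ 0) (k : ℕ) (hk : k ≤ n) :
    (ascPochhammer ℂ k).eval (s+2) ≠ 0 := by
  induction k with
  | zero => simp
  | succ k ih =>
    rw [ascPochhammer_succ_eval]
    refine mul_ne_zero (ih (by omega)) ?_
    have := h (2+k) (by omega) (by omega)
    push_cast at this
    rwa [add_assoc]

theorem vand (n : ℕ) (hn : n ≠ 0) (s : ℂ) (h : ∀ k ≤ n, (ascPochhammer ℂ k).eval (s+2) ≠ 0) :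
    ∑ l ∈ Finset.range (n+1), (-1:ℂ)^l * (n.choose l : ℂ) * ((ascPochhammer ℂ l).eval (s+n+1) / (ascPochhammer ℂ l).eval (s+2)) = 0 := by
  obtain ⟨N, rfl⟩ := Nat.exists_eq_succ_of_ne_zero hn
  have h1 := congrFun (Polynomial.fwdDiff_iter_eq_zero_of_degree_lt (P := ascPochhammer ℂ N) (n := N+1) (by rw [ascPochhammer_natDegree]; omega)) (s+2)
  rw [fwdDiff_iter_eq_sum_shift] at h1
  have h2 := congrArg (fun z => (-1:ℂ)^(N+1) / (ascPochhammer ℂ N).eval (s+2) * z) h1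
  simp only [Pi.zero_apply, mul_zero, Finset.mul_sum] at h2
  rw [← h2]
  refine Finset.sum_congr rfl fun l hl => ?_
  have hl' : l ≤ N + 1 := by simpa [Nat.lt_succ_iff] using hl
  have e1 := pp_add (s+2) N l
  have e2 := pp_add (s+2) l N
  rw [add_comm l N] at e2
  rw [e1] at e2
  have a1 : s + ((N+1 : ℕ):ℂ) + 1 = s + 2 + N := by push_cast; ring
  have n1 := h l hl'
  have n2 := h N (by omega)
  have s1 : (-1:ℂ)^(N+1) * (-1)^(N+1-l) = (-1)^l := by
    obtain ⟨t, ht⟩ := Nat.exists_eq_add_of_le hl'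
    rw [ht, Nat.add_sub_cancel_left, pow_add, mul_assoc, ← mul_pow]; simp
  simp only [Nat.succ_eq_add_one]
  rw [a1, ← s1]
  simp only [zsmul_eq_mul, nsmul_eq_mul, mul_one]
  push_cast
  field_simp
  linear_combination (((N+1).choose l : ℂ)) * e2

theorem term (α β x : ℂ) (l j i r : ℕ) (h : ∀ k ≤ l + j, (ascPochhammer ℂ k).eval (α+β+2) ≠ 0) :
    (ascPochhammer ℂ (l+j)).eval (α + β + ((l+j+i+r : ℕ) : ℂ) + 1) /
            (ascPochhammer ℂ (l+j)).eval (α + β + 2) *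
    (((ascPochhammer ℂ i).eval (((i+r : ℕ) : ℂ) + (α + ((l+j:ℕ):ℂ)) + (β + ((l+j:ℕ):ℂ)) + 1) *
        (ascPochhammer ℂ r).eval (α + ((l+j:ℕ):ℂ) + (i : ℂ) + 1)) /
      ((i.factorial : ℂ) * (r.factorial : ℂ)) * x ^ i) *
    (((ascPochhammer ℂ j).eval (((l+j : ℕ) : ℂ) + (-α - ((l+j:ℕ):ℂ) - 1) + (-β - ((l+j:ℕ):ℂ) - 1) + 1) *
        (ascPochhammer ℂ l).eval (-α - ((l+j:ℕ):ℂ) - 1 + (j : ℂ) + 1)) /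
      ((j.factorial : ℂ) * (l.factorial : ℂ)) * x ^ j)
    = ((-1)^l * (ascPochhammer ℂ (l + (i+j))).eval (α + β + ((l+j+i+r : ℕ) : ℂ) + 1) *
       (ascPochhammer ℂ r).eval (α + ((l+(i+j) : ℕ):ℂ) + 1) * (ascPochhammer ℂ l).eval (α+1) /
       ((r.factorial : ℂ) * l.factorial * (i+j).factorial * (ascPochhammer ℂ l).eval (α + β + 2)) * x ^ (i+j)) *
      ((-1)^j * ((i+j).choose j : ℂ)) := by
  have c : ((i+j).choose j : ℂ) = (i+j).factorial / (i.factorial * j.factorial) := by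
    exact chz i j
  have e1 : ((l+j : ℕ) : ℂ) + (-α - ((l+j:ℕ):ℂ) - 1) + (-β - ((l+j:ℕ):ℂ) - 1) + 1 = 1 - (α+β+2+l) - j := by
    push_cast; ring
  have e2 : -α - ((l+j:ℕ):ℂ) - 1 + (j : ℂ) + 1 = 1 - (α+1) - l := by push_cast; ring
  have e3 : ((i+r : ℕ) : ℂ) + (α + ((l+j:ℕ):ℂ)) + (β + ((l+j:ℕ):ℂ)) + 1 = (α + β + ((l+j+i+r : ℕ) : ℂ) + 1) + ((l+j:ℕ):ℂ) := by
    push_cast; ring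
  have e4 : α + ((l+j:ℕ):ℂ) + (i : ℂ) + 1 = α + ((l+(i+j) : ℕ):ℂ) + 1 := by push_cast; ring
  rw [c, e1, e2, e3, e4, pp_refl, pp_refl, show l + (i+j) = (l+j)+i by ring, pp_add _ (l+j) i]
  have n1 := h l (by omega)
  have n2 := h (l+j) le_rfl
  rw [pp_add] at n2 ⊢
  have n3 := right_ne_zero_of_mul n2
  have f1 : (i.factorial : ℂ) ≠ 0 := by exact_mod_cast i.factorial_ne_zero
  have f2 : (j.factorial : ℂ) ≠ 0 := by exact_mod_cast j.factorial_ne_zero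
  have f3 : (l.factorial : ℂ) ≠ 0 := by exact_mod_cast l.factorial_ne_zero
  have f4 : (r.factorial : ℂ) ≠ 0 := by exact_mod_cast r.factorial_ne_zero
  have f5 : ((i+j).factorial : ℂ) ≠ 0 := by exact_mod_cast (i+j).factorial_ne_zero
  rw [← pp_add _ l j]
  generalize Polynomial.eval (α + β + ((l+j+i+r : ℕ) : ℂ) + 1) (ascPochhammer ℂ (l+j)) = A
  generalize Polynomial.eval (α + β + ((l+j+i+r : ℕ) : ℂ) + 1 + ((l+j:ℕ):ℂ)) (ascPochhammer ℂ i) = B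
  rw [pp_add _ l j, pow_add x]
  field_simp

theorem alt (m : ℕ) : ∑ j ∈ Finset.range (m+1), ((-1:ℂ)^j * (m.choose j : ℂ)) = if m = 0 then 1 else 0 := by
  have := congrArg (Int.cast (R := ℂ)) (Int.alternating_sum_range_choose (n := m))
  push_cast at this
  simpa using this



/-- The Jacobi polynomial `P_n^{(α,β)}(x)` for arbitrary complex parameters,
defined by `P_n^{(α,β)}(x) = ∑_{k=0}^n ((n+α+β+1)_k (α+k+1)_{n-k})/(k! (n-k)!) ((x-1)/2)^k`. -/
noncomputable def jacobiP (n : ℕ) (α β x : ℂ) : ℂ :=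
  ∑ k ∈ Finset.range (n + 1),
    ((ascPochhammer ℂ k).eval ((n : ℂ) + α + β + 1) *
        (ascPochhammer ℂ (n - k)).eval (α + (k : ℂ) + 1)) /
      ((k.factorial : ℂ) * ((n - k).factorial : ℂ)) * ((x - 1) / 2) ^ k

theorem stmt19 (n : ℕ) (α β : ℂ)
    (h : ∀ j : ℤ, 2 ≤ j → j ≤ (n : ℤ) + 1 → α + β + (j : ℂ) ≠ 0) (x : ℂ) :
    ∑ k ∈ Finset.range (n + 1),
        (ascPochhammer ℂ k).eval (α + β + (n : ℂ) + 1) /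
            (ascPochhammer ℂ k).eval (α + β + 2) *
          jacobiP (n - k) (α + (k : ℂ)) (β + (k : ℂ)) x *
          jacobiP k (-α - (k : ℂ) - 1) (-β - (k : ℂ) - 1) x
      = (if n = 0 then 1 else 0) := by
  have hp := pp_ne n (α+β) h
  have key : ∀ k ∈ Finset.range (n+1), (ascPochhammer ℂ k).eval (α + β + (n : ℂ) + 1) /
            (ascPochhammer ℂ k).eval (α + β + 2) *
          jacobiP (n - k) (α + (k : ℂ)) (β + (k : ℂ)) x *
          jacobiP k (-α - (k : ℂ) - 1) (-β - (k : ℂ) - 1) x =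
      ∑ i ∈ Finset.range (n-k+1), ∑ j ∈ Finset.range (k+1),
        (ascPochhammer ℂ k).eval (α + β + (n : ℂ) + 1) /
            (ascPochhammer ℂ k).eval (α + β + 2) *
        (((ascPochhammer ℂ i).eval (((n-k : ℕ) : ℂ) + (α + (k:ℂ)) + (β + (k:ℂ)) + 1) *
        (ascPochhammer ℂ (n-k-i)).eval (α + (k:ℂ) + (i : ℂ) + 1)) /
      ((i.factorial : ℂ) * ((n-k-i).factorial : ℂ)) * ((x - 1) / 2) ^ i) *
    (((ascPochhammer ℂ j).eval ((k : ℂ) + (-α - (k:ℂ) - 1) + (-β - (k:ℂ) - 1) + 1) *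
        (ascPochhammer ℂ (k-j)).eval (-α - (k:ℂ) - 1 + (j : ℂ) + 1)) /
      ((j.factorial : ℂ) * ((k-j).factorial : ℂ)) * ((x - 1) / 2) ^ j) := by
    intro k _
    unfold jacobiP
    rw [mul_assoc, Finset.sum_mul_sum, Finset.mul_sum]
    refine Finset.sum_congr rfl fun i _ => ?_
    rw [Finset.mul_sum]
    refine Finset.sum_congr rfl fun j _ => ?_
    ring
  rw [Finset.sum_congr rfl key, reidx]
  have key2 : ∀ l ∈ Finset.range (n+1), ∀ m ∈ Finset.range (n-l+1), ∀ j ∈ Finset.range (m+1), 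
     (ascPochhammer ℂ (l+j)).eval (α + β + (n : ℂ) + 1) /
            (ascPochhammer ℂ (l+j)).eval (α + β + 2) *
        (((ascPochhammer ℂ (m-j)).eval (((n-(l+j) : ℕ) : ℂ) + (α + ((l+j:ℕ):ℂ)) + (β + ((l+j:ℕ):ℂ)) + 1) *
        (ascPochhammer ℂ (n-(l+j)-(m-j))).eval (α + ((l+j:ℕ):ℂ) + ((m-j:ℕ) : ℂ) + 1)) /
      (((m-j).factorial : ℂ) * ((n-(l+j)-(m-j)).factorial : ℂ)) * ((x - 1) / 2) ^ (m-j)) *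
    (((ascPochhammer ℂ j).eval (((l+j:ℕ) : ℂ) + (-α - ((l+j:ℕ):ℂ) - 1) + (-β - ((l+j:ℕ):ℂ) - 1) + 1) *
        (ascPochhammer ℂ (l+j-j)).eval (-α - ((l+j:ℕ):ℂ) - 1 + (j : ℂ) + 1)) /
      ((j.factorial : ℂ) * ((l+j-j).factorial : ℂ)) * ((x - 1) / 2) ^ j) =
     ((-1)^l * (ascPochhammer ℂ (l + m)).eval (α + β + (n : ℂ) + 1) *
       (ascPochhammer ℂ (n-l-m)).eval (α + ((l+m : ℕ):ℂ) + 1) * (ascPochhammer ℂ l).eval (α+1) /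
       (((n-l-m).factorial : ℂ) * l.factorial * m.factorial * (ascPochhammer ℂ l).eval (α + β + 2)) * ((x-1)/2) ^ m) *
      ((-1)^j * (m.choose j : ℂ)) := by
    intro l hl m hm j hj
    simp only [Finset.mem_range] at hl hm hj
    obtain ⟨i, rfl⟩ : ∃ i, m = i + j := ⟨m - j, by omega⟩
    obtain ⟨r, rfl⟩ : ∃ r, n = l + j + i + r := ⟨n - (l + j + i), by omega⟩
    have t := term α β ((x-1)/2) l j i r (fun k hk => hp k (by omega))
    have q1 : l + j + i + r - (l+j) - (i + j - j) = r := by omega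
    have q2 : l + j + i + r - (l+j) = i + r := by omega
    have q3 : l + j + i + r - l - (i+j) = r := by omega
    rw [q1, q2, q3, Nat.add_sub_cancel, Nat.add_sub_cancel]
    exact t
  rw [Finset.sum_congr rfl fun l hl => Finset.sum_congr rfl fun m hm => Finset.sum_congr rfl (key2 l hl m hm)]
  simp only [← Finset.mul_sum, alt]
  simp only [mul_ite, mul_one, mul_zero, Finset.sum_ite_eq', Finset.mem_range, Nat.succ_pos, if_true]
  rcases eq_or_ne n 0 with rfl | hn
  · simp
  rw [if_neg hn]
  have v := congrArg (fun z => (ascPochhammer ℂ n).eval (α+1) / (n.factorial : ℂ) * z) (vand n hn (α+β) hp)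
  simp only [mul_zero, Finset.mul_sum] at v
  rw [← v]
  refine Finset.sum_congr rfl fun l hl => ?_
  simp only [Finset.mem_range] at hl
  obtain ⟨r, rfl⟩ : ∃ r, n = l + r := ⟨n - l, by omega⟩
  have n1 := hp l (by omega)
  have f1 : (r.factorial : ℂ) ≠ 0 := by exact_mod_cast r.factorial_ne_zero
  have f3 : (l.factorial : ℂ) ≠ 0 := by exact_mod_cast l.factorial_ne_zero
  have f2 : ((l+r).factorial : ℂ) ≠ 0 := by exact_mod_cast (l+r).factorial_ne_zero
  have c : ((l+r).choose l : ℂ) = (l+r).factorial / (l.factorial * r.factorial) := by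
    rw [add_comm l r, chz r l, mul_comm (r.factorial : ℂ)]
  rw [c, pp_add (α+1) l r, Nat.add_sub_cancel_left, show α + ((l+0:ℕ):ℂ) + 1 = α + 1 + l by push_cast; ring]
  simp only [Nat.add_zero, Nat.sub_zero, Nat.factorial_zero, Nat.cast_one, mul_one, pow_zero]
  field_simp
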